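/- arXiv:1704.04474 — 7 statements merged into one kernel-verified Lean document; each statement's English description precedes it below -/
import Mathlib

section
/- Unique lifting of factorizations for the length functor on a free category: let V be a quiver, x and z vertices, p : Quiver.Path x z a path, and m, n : ℕ with p.length = m + n. Then there exists a unique triple consisting of a vertex y, a path q : Quiver.Path x y with q.length = m, and a path r : Quiver.Path y z with r.length = n, such that p = q.comp r. -/
/-- Two factorizations of a path whose second factors have equal length agree, including their
middle vertices. -/
theorem Quiver.Path.sigma_eq_of_comp_eq_comp {V : Type*} [Quiver V] {x y y' z : V}
    {q : Quiver.Path x y} {r : Quiver.Path y z} {q' : Quiver.Path x y'} {r' : Quiver.Path y' z}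
    (hr : r.length = r'.length) (h : q.comp r = q'.comp r') :
    (⟨y, q, r⟩ : Σ y : V, Quiver.Path x y × Quiver.Path y z) = ⟨y', q', r'⟩ := by
  induction r with
  | nil =>
    cases r' with
    | nil => cases h; rfl
    | cons r' f => cases hr
  | cons r e ih =>
    cases r' with
    | nil => cases hr
    | cons r' f =>
      simp only [Quiver.Path.comp_cons, Quiver.Path.cons.injEq] at h
      obtain ⟨rfl, hc, he⟩ := h
      cases he
      cases ih (Nat.succ.inj hr) hc.eq
      rfl

/-- Unique lifting of factorizations for the length functor on a free category:
given a quiver `V`, vertices `x z`, a path `p : Quiver.Path x z` and `m n : ℕ` with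
`p.length = m + n`, there is a unique triple consisting of a vertex `y`, a path
`q : Quiver.Path x y` of length `m` and a path `r : Quiver.Path y z` of length `n`
such that `p = q.comp r`. -/
theorem path_unique_lifting_of_factorizations {V : Type u} [Quiver.{v + 1} V] {x z : V}
    (p : Quiver.Path x z) (m n : ℕ) (h : p.length = m + n) :
    ∃! t : Σ y : V, Quiver.Path x y × Quiver.Path y z,
      t.2.1.length = m ∧ t.2.2.length = n ∧ p = t.2.1.comp t.2.2 := by
  obtain ⟨y, q, r, rfl, hq⟩ := p.exists_eq_comp_of_le_length (n := m) (by omega)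
  have hr : r.length = n := by
    rw [Quiver.Path.length_comp] at h
    omega
  refine ⟨⟨y, q, r⟩, ⟨hq, hr, rfl⟩, ?_⟩
  rintro ⟨y', q', r'⟩ ⟨-, hr', h'⟩
  exact Quiver.Path.sigma_eq_of_comp_eq_comp (hr'.trans hr.symm) h'.symm
end

section
/- There exists a category C with finitely many objects and finitely many morphisms that is not thin, but whose groupoidification, the localization (⊤ : MorphismProperty C).Localization of C at all of its morphisms, is thin. -/
open CategoryTheory

/-- If the localization functor is constant, the localized category is thin. -/
theorem isThin_localization_of_Q_eq_const {C : Type*} [Category* C] (W : MorphismProperty C)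
    (X : W.Localization) (h : W.Q = (Functor.const C).obj X) : Quiver.IsThin W.Localization := by
  have hid : 𝟭 W.Localization = (Functor.const _).obj X :=
    Localization.Construction.uniq _ _ h
  refine fun A B ↦ ⟨fun f g ↦ ?_⟩
  exact (Functor.congr_hom hid f).trans (Functor.congr_hom hid g).symm

/-- In the groupoidification of a monoid with zero, every element becomes the identity, since
multiplication by zero absorbs it and zero becomes invertible. -/
theorem Q_map_singleObj_eq_id {M : Type*} [MonoidWithZero M]
    (m : SingleObj.star M ⟶ SingleObj.star M) :
    (⊤ : MorphismProperty (SingleObj M)).Q.map m = 𝟙 _ := by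
  let z : SingleObj.star M ⟶ SingleObj.star M := (0 : M)
  have := MorphismProperty.Q_inverts (⊤ : MorphismProperty (SingleObj M)) z trivial
  have hz : m ≫ z = z := zero_mul (M₀ := M) m
  rw [← cancel_mono ((⊤ : MorphismProperty (SingleObj M)).Q.map z), ← Functor.map_comp, hz,
    Category.id_comp]

/-- The groupoidification of a monoid with zero, seen as a one-object category, is thin. -/
theorem isThin_localization_singleObj (M : Type*) [MonoidWithZero M] :
    Quiver.IsThin (⊤ : MorphismProperty (SingleObj M)).Localization := by
  refine isThin_localization_of_Q_eq_const _ (MorphismProperty.Q _ |>.obj (SingleObj.star M)) ?_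
  refine CategoryTheory.Functor.ext (fun _ ↦ rfl) fun _ _ m ↦ ?_
  simp only [eqToHom_refl, Functor.const_obj_map, Category.comp_id]
  exact Q_map_singleObj_eq_id m

/-- There is a category `C` with finitely many objects and finitely many morphisms that is
not thin, but whose groupoidification — the localization
`(⊤ : MorphismProperty C).Localization` of `C` at all of its morphisms — is thin. -/
theorem exists_not_thin_with_thin_localization :
    ∃ (C : Type) (inst : Category.{0} C),
      letI := inst
      Finite C ∧ (∀ x y : C, Finite (x ⟶ y)) ∧
        ¬ Quiver.IsThin C ∧ Quiver.IsThin (⊤ : MorphismProperty C).Localization := by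
  refine ⟨SingleObj (ZMod 2), inferInstance, inferInstanceAs (Finite Unit),
    fun _ _ ↦ inferInstanceAs (Finite (ZMod 2)), fun h ↦ ?_, isThin_localization_singleObj _⟩
  have : Subsingleton (ZMod 2) := h (SingleObj.star _) (SingleObj.star _)
  exact zero_ne_one (Subsingleton.elim (0 : ZMod 2) 1)
end

section
/- Let V be a quiver such that the path category Paths V is thin and for any two vertices x, y there is a path from x to y or a path from y to x (so Paths V is a totally ordered set). Then: (i) for every vertex x and every m : ℕ, there is at most one path of length m with source x, i.e. if p : Quiver.Path x y and q : Quiver.Path x z satisfy p.length = q.length = m then y = z and p equals q (after transporting along y = z); (ii) if x is not a greatest element, i.e. there exists a vertex w with no path from w to x, then there is exactly one arrow of V with source x: there is a unique pair (y, a) with a : x ⟶ y an arrow of V. -/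
open CategoryTheory

namespace Quiver

theorem sigma_hom_eq_of_path {V : Type*} [Quiver V]
    (hthin : ∀ x y : V, Subsingleton (Path x y)) {x y z : V}
    (a : x ⟶ y) (b : x ⟶ z) (p : Path y z) :
    (⟨y, a⟩ : Σ y : V, x ⟶ y) = ⟨z, b⟩ := by
  have h : a.toPath.comp p = b.toPath := (hthin x z).elim _ _
  cases p with
  | nil =>
    obtain rfl : a = b := eq_of_heq (Path.hom_heq_of_cons_eq_cons h)
    rfl
  | cons p e =>
    have hlen := congrArg Path.length h
    simp only [Path.length_comp, Path.length_toPath, Path.length_cons] at hlen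
    omega

theorem subsingleton_sigma_hom {V : Type*} [Quiver V]
    (hthin : ∀ x y : V, Subsingleton (Path x y))
    (htot : ∀ x y : V, Nonempty (Path x y) ∨ Nonempty (Path y x)) (x : V) :
    Subsingleton (Σ y : V, x ⟶ y) := by
  refine ⟨fun ⟨y, a⟩ ⟨z, b⟩ => ?_⟩
  obtain ⟨⟨p⟩⟩ | ⟨⟨p⟩⟩ := htot y z
  · exact sigma_hom_eq_of_path hthin a b p
  · exact (sigma_hom_eq_of_path hthin b a p).symm

theorem Path.eq_of_length_eq {V : Type*} [Quiver V]
    (hsub : ∀ x : V, Subsingleton (Σ y : V, x ⟶ y)) {x y z : V}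
    (p : Path x y) (q : Path x z) (h : p.length = q.length) :
    ∃ h : y = z, p.cast rfl h = q := by
  induction p generalizing z with
  | nil =>
    cases q with
    | nil => exact ⟨rfl, rfl⟩
    | cons q b => simp at h
  | cons p a ih =>
    cases q with
    | nil => simp at h
    | cons q b =>
      obtain ⟨rfl, rfl⟩ := ih q (Nat.succ.inj h)
      cases (hsub _).elim ⟨_, a⟩ ⟨_, b⟩
      exact ⟨rfl, rfl⟩

theorem Path.eq_or_nonempty_sigma_hom {V : Type*} [Quiver V] {x y : V} (p : Path x y) :
    x = y ∨ Nonempty (Σ y : V, x ⟶ y) := by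
  induction p with
  | nil => exact .inl rfl
  | cons p a ih =>
    obtain rfl | h := ih
    · exact .inr ⟨⟨_, a⟩⟩
    · exact .inr h

end Quiver

/-- Let `V` be a quiver whose path category is thin and totally connected (for any two
vertices there is a path one way or the other), so that `Paths V` is a totally ordered set.
Then (i) for every vertex `x`, any two paths out of `x` of the same length have the same
target and are equal (after transporting along the equality of targets); and (ii) if `x` is
not a greatest element (there is a vertex `w` with no path from `w` to `x`), then there is
exactly one arrow of `V` with source `x`. -/
theorem totally_ordered_paths_unique_of_length {V : Type u} [Quiver.{v + 1} V]
    (hthin : Quiver.IsThin (Paths V))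
    (htot : ∀ x y : V, Nonempty (Quiver.Path x y) ∨ Nonempty (Quiver.Path y x)) :
    (∀ {x y z : V} (p : Quiver.Path x y) (q : Quiver.Path x z),
      p.length = q.length → ∃ h : y = z, p.cast rfl h = q) ∧
    (∀ x : V, (∃ w : V, ¬ Nonempty (Quiver.Path w x)) →
      ∃! t : Σ y : V, x ⟶ y, True) := by
  have hpath (x y : V) : Subsingleton (Quiver.Path x y) := hthin x y
  have hsub := Quiver.subsingleton_sigma_hom hpath htot
  refine ⟨fun p q h => Quiver.Path.eq_of_length_eq hsub p q h, fun x ⟨w, hw⟩ => ?_⟩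
  obtain ⟨p⟩ := (htot w x).resolve_left hw
  obtain rfl | ⟨⟨t⟩⟩ := p.eq_or_nonempty_sigma_hom
  · exact absurd ⟨.nil⟩ hw
  · exact ⟨t, trivial, fun s _ => (hsub x).elim s t⟩
end

section
/- Classification of totally ordered free categories: let V be a quiver such that the path category Paths V is thin and for any two vertices x, y there is a path from x to y or a path from y to x. Then the linear order on the vertices of V defined by x ≤ y ↔ Nonempty (Quiver.Path x y) is order-isomorphic to Fin n for some n : ℕ, or to ℕ, or to ℕᵒᵈ (the order dual of ℕ), or to ℤ. -/
open CategoryTheory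

/-- A locally finite linear order is isomorphic to `Fin n` for some `n`, to `ℕ`, to `ℕᵒᵈ`, or
to `ℤ`. -/
theorem LocallyFiniteOrder.orderIso_classification (α : Type*) [LinearOrder α]
    [LocallyFiniteOrder α] :
    (∃ n : ℕ, Nonempty (α ≃o Fin n)) ∨ Nonempty (α ≃o ℕ) ∨ Nonempty (α ≃o ℕᵒᵈ) ∨
      Nonempty (α ≃o ℤ) := by
  let _ : SuccOrder α := LinearLocallyFiniteOrder.succOrder α
  let _ : PredOrder α := LinearLocallyFiniteOrder.predOrder α
  rcases isEmpty_or_nonempty α with _ | _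
  · exact Or.inl ⟨0, ⟨OrderIso.ofIsEmpty α (Fin 0)⟩⟩
  by_cases hmin : ∃ a : α, IsMin a
  · obtain ⟨a, ha⟩ := hmin
    let _ : OrderBot α := { bot := a, bot_le := ha.isBot }
    by_cases hmax : ∃ b : α, IsMax b
    · obtain ⟨b, hb⟩ := hmax
      let _ : Fintype α := ⟨Finset.Icc a b, fun x => Finset.mem_Icc.2 ⟨ha.isBot x, hb.isTop x⟩⟩
      exact Or.inl ⟨_, ⟨(Fintype.orderIsoFinOfCardEq α rfl).symm⟩⟩
    · have : NoMaxOrder α := noMaxOrder_iff.2 (not_exists.1 hmax)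
      exact Or.inr (Or.inl ⟨orderIsoNatOfLinearSuccPredArch⟩)
  · have : NoMinOrder α := noMinOrder_iff.2 (not_exists.1 hmin)
    by_cases hmax : ∃ b : α, IsMax b
    · obtain ⟨b, hb⟩ := hmax
      let _ : OrderTop α := { top := b, le_top := hb.isTop }
      exact Or.inr (Or.inr (Or.inl ⟨(OrderIso.dualDual α).trans
        (orderIsoNatOfLinearSuccPredArch (ι := αᵒᵈ)).dual⟩))
    · have : NoMaxOrder α := noMaxOrder_iff.2 (not_exists.1 hmax)
      exact Or.inr (Or.inr (Or.inr ⟨orderIsoIntOfLinearSuccPredArch⟩))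

namespace Quiver

/-- If the only path from `x` to itself is the trivial one, then `x` and `y` coincide as soon as there
are paths from `x` to `y` and back. -/
theorem Path.eq_of_subsingleton {V : Type*} [Quiver V] {x y : V} [Subsingleton (Path x x)]
    (p : Path x y) (q : Path y x) : x = y := by
  have h := congrArg Path.length (Subsingleton.elim (p.comp q) Path.nil)
  rw [Path.length_comp, Path.length_nil] at h
  exact p.eq_of_length_zero (Nat.eq_zero_of_add_eq_zero_right h)

/-- If there is at most one path from `x` to `y`, then only finitely many vertices lie on paths
from `x` to `y`. -/
theorem finite_setOf_path_between {V : Type*} [Quiver V] (x y : V) [Subsingleton (Path x y)] :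
    {z : V | Nonempty (Path x z) ∧ Nonempty (Path z y)}.Finite := by
  rcases isEmpty_or_nonempty (Path x y) with h | ⟨⟨p⟩⟩
  · refine Set.Finite.subset Set.finite_empty ?_
    rintro z ⟨⟨q⟩, ⟨r⟩⟩
    exact h.elim (q.comp r)
  · refine p.vertices.finite_toSet.subset ?_
    rintro z ⟨⟨q⟩, ⟨r⟩⟩
    change z ∈ p.vertices
    rw [Subsingleton.elim p (q.comp r), Path.vertices_comp]
    exact List.mem_append_right _ r.start_mem_vertices

end Quiver

/-- Classification of totally ordered free categories: if `V` is a quiver such that the path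
category `Paths V` is thin and for any two vertices there is a path one way or the other,
then the order `x ≤ y ↔ Nonempty (Quiver.Path x y)` on the vertices is order-isomorphic to
`Fin n` for some `n`, or to `ℕ`, or to `ℕᵒᵈ`, or to `ℤ`. -/
theorem totally_ordered_paths_classification {V : Type u} [Quiver.{v + 1} V]
    (hthin : Quiver.IsThin (Paths V))
    (htot : ∀ x y : V, Nonempty (Quiver.Path x y) ∨ Nonempty (Quiver.Path y x)) :
    (∃ n : ℕ, Nonempty ((fun x y : V => Nonempty (Quiver.Path x y)) ≃r
        ((· ≤ ·) : Fin n → Fin n → Prop))) ∨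
    Nonempty ((fun x y : V => Nonempty (Quiver.Path x y)) ≃r ((· ≤ ·) : ℕ → ℕ → Prop)) ∨
    Nonempty ((fun x y : V => Nonempty (Quiver.Path x y)) ≃r ((· ≤ ·) : ℕᵒᵈ → ℕᵒᵈ → Prop)) ∨
    Nonempty ((fun x y : V => Nonempty (Quiver.Path x y)) ≃r ((· ≤ ·) : ℤ → ℤ → Prop)) := by
  have hsub (x y : V) : Subsingleton (Quiver.Path x y) := hthin x y
  let _ : LinearOrder V :=
    { le := fun x y => Nonempty (Quiver.Path x y)
      le_refl := fun _ => ⟨Quiver.Path.nil⟩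
      le_trans := fun _ _ _ ⟨p⟩ ⟨q⟩ => ⟨p.comp q⟩
      le_antisymm := fun _ _ ⟨p⟩ ⟨q⟩ => p.eq_of_subsingleton q
      le_total := htot
      toDecidableLE := Classical.decRel _ }
  let _ : LocallyFiniteOrder V :=
    LocallyFiniteOrder.ofFiniteIcc fun x y => Quiver.finite_setOf_path_between x y
  exact LocallyFiniteOrder.orderIso_classification V
end

section
/- Freeness of groupoids is preserved by equivalences: let G and H be small groupoids (objects and morphisms in the same universe) and suppose there is an equivalence of categories G ≌ H. If G is a free groupoid, i.e. Nonempty (IsFreeGroupoid G), then H is a free groupoid, i.e. Nonempty (IsFreeGroupoid H). -/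
open CategoryTheory

universe u

namespace IsFreeGroupoid

/-- A multiplicative function on the arrows of a category with values in a group, as a functor to
the corresponding one-object groupoid. -/
def functorOfMap {C : Type*} [Category* C] {X : Type*} [Group X]
    (m : ∀ {a b : C}, (a ⟶ b) → X)
    (hm : ∀ {a b c : C} (p : a ⟶ b) (q : b ⟶ c), m (p ≫ q) = m q * m p) :
    C ⥤ SingleObj X where
  obj _ := SingleObj.star X
  map p := m p
  map_id a := by
    have h := hm (𝟙 a) (𝟙 a)
    rw [Category.comp_id] at h
    exact left_eq_mul.mp h
  map_comp p q := hm p q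

/-- The value in the group `X` of a functor to the one-object groupoid of `X`. -/
def mapVal {C : Type*} [Category* C] {X : Type*} [Group X] (F : C ⥤ SingleObj X) {a b : C}
    (p : a ⟶ b) : X := F.map p

section mapVal

variable {C : Type*} [Category* C] {X : Type*} [Group X]

lemma mapVal_comp (F : C ⥤ SingleObj X) {a b c : C} (p : a ⟶ b) (q : b ⟶ c) :
    mapVal F (p ≫ q) = mapVal F q * mapVal F p := F.map_comp p q

lemma mapVal_id (F : C ⥤ SingleObj X) (a : C) : mapVal F (𝟙 a) = 1 := F.map_id a

lemma mapVal_injective {F F' : C ⥤ SingleObj X}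
    (h : ∀ {a b : C} (p : a ⟶ b), mapVal F p = mapVal F' p) : F = F' :=
  Functor.hext (fun _ => rfl) fun _ _ p => heq_of_eq (h p)

/-- The homomorphism from a monoid of endomorphisms induced by a functor to a group. -/
def endHom (F : C ⥤ SingleObj X) (a : C) : End a →* X where
  toFun p := mapVal F p
  map_one' := mapVal_id F a
  map_mul' p q := mapVal_comp F q p

end mapVal

/-! ### Restriction of a free groupoid to a component -/

section Component

variable {G : Type u} [Groupoid.{u} G]

/-- The component of an object of a groupoid, as a full subgroupoid. -/
abbrev Component (x : G) : Type u :=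
  InducedCategory G (Subtype.val : {y : G // Nonempty (x ⟶ y)} → G)

instance (x : G) : IsConnected (Component x) :=
  have : Nonempty (Component x) := ⟨⟨x, ⟨𝟙 x⟩⟩⟩
  zigzag_isConnected fun a b =>
    .of_hom (InducedCategory.homMk (inv a.2.some ≫ b.2.some))

open scoped Classical in
/-- A functor from a component to a group extends to the groupoid by the trivial functor on the
other components. -/
noncomputable def extendFromComponent {x : G} {X : Type*} [Group X]
    (E : Component x ⥤ SingleObj X) : G ⥤ SingleObj X :=
  functorOfMap
    (fun {a b} p => if h : Nonempty (x ⟶ a) then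
      mapVal E (a := ⟨a, h⟩) (b := ⟨b, ⟨h.some ≫ p⟩⟩) (InducedCategory.homMk p) else 1)
    (by
      intro a b c p q
      by_cases ha : Nonempty (x ⟶ a)
      · have hb : Nonempty (x ⟶ b) := ⟨ha.some ≫ p⟩
        rw [dif_pos ha, dif_pos ha, dif_pos hb, ← mapVal_comp]
        rfl
      · have hb : ¬ Nonempty (x ⟶ b) := fun hb => ha ⟨hb.some ≫ inv p⟩
        rw [dif_neg ha, dif_neg ha, dif_neg hb, one_mul])

lemma mapVal_extendFromComponent {x : G} {X : Type*} [Group X]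
    (E : Component x ⥤ SingleObj X) {a b : G} (ha : Nonempty (x ⟶ a)) (hb : Nonempty (x ⟶ b))
    (p : a ⟶ b) : mapVal (extendFromComponent E) p =
      mapVal E (a := ⟨a, ha⟩) (b := ⟨b, hb⟩) (InducedCategory.homMk p) :=
  dif_pos ha

lemma mapVal_extendFromComponent_of_isEmpty {x : G} {X : Type*} [Group X]
    (E : Component x ⥤ SingleObj X) {a b : G} (ha : ¬ Nonempty (x ⟶ a)) (p : a ⟶ b) :
    mapVal (extendFromComponent E) p = 1 :=
  dif_neg ha

variable [IsFreeGroupoid G]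

open scoped Classical in
/-- A component of a free groupoid is free on the generators it contains. -/
noncomputable instance (x : G) : IsFreeGroupoid (Component x) where
  quiverGenerators := ⟨fun a b => (show Generators G from a.1) ⟶ (show Generators G from b.1)⟩
  of e := InducedCategory.homMk (of (G := G) e)
  unique_lift {X} _ f := by
    let f' : ∀ a b : G, @Quiver.Hom (Generators G) _ a b → X := fun a b e =>
      if h : Nonempty (x ⟶ a) then f (a := ⟨a, h⟩) (b := ⟨b, ⟨h.some ≫ of e⟩⟩) e else 1
    obtain ⟨F, hF, uF⟩ := unique_lift (G := G) f'
    refine ⟨inducedFunctor _ ⋙ F, fun a b e => (hF a.1 b.1 e).trans (dif_pos a.2),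
      fun E hE => ?_⟩
    have hE' : ∀ (a b : G) (e : @Quiver.Hom (Generators G) _ a b),
        mapVal (C := G) (extendFromComponent E) (of e) = f' a b e := by
      intro a b e
      by_cases ha : Nonempty (x ⟶ a)
      · rw [mapVal_extendFromComponent E ha ⟨ha.some ≫ of e⟩]
        refine (hE ⟨a, ha⟩ ⟨b, _⟩ e).trans ?_
        simp only [f', dif_pos ha]
      · rw [mapVal_extendFromComponent_of_isEmpty E ha]
        simp only [f', dif_neg ha]
    have key : extendFromComponent E = F := uF _ hE'
    subst key
    exact mapVal_injective fun {a b} p => (mapVal_extendFromComponent E a.2 b.2 p.hom).symm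

/-- The vertex groups of a free groupoid are free. -/
theorem isFreeGroup_end (x : G) : IsFreeGroup (End x) :=
  let c : Component x := ⟨x, ⟨𝟙 x⟩⟩
  have := endIsFreeOfConnectedFree c
  have e : End c ≃* End x := (fullyFaithfulInducedFunctor _).mulEquivEnd c
  IsFreeGroup.ofMulEquiv e

end Component

/-! ### Groupoids with free vertex groups -/

section FreeEnd

variable {H : Type u} [Groupoid.{u} H]

/-- The isomorphism classes of objects of a groupoid. -/
abbrev Class (H : Type u) [Groupoid.{u} H] : Type u := Quotient (isIsomorphicSetoid H)

/-- The isomorphism class of an object. -/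
abbrev toClass (a : H) : Class H := Quotient.mk _ a

lemma toClass_eq_of_hom {a b : H} (p : a ⟶ b) : toClass a = toClass b :=
  Quotient.sound ⟨asIso p⟩

open scoped Classical in
/-- An arrow from the base point of a component to each of its objects, the identity at the base
point itself. -/
noncomputable def spoke (q : Class H) (a : H) (h : q = toClass a) : q.out ⟶ a :=
  if h' : q.out = a then eqToHom h'
  else (Quotient.exact (q.out_eq.trans h) : Nonempty (q.out ≅ a)).some.hom

lemma spoke_out (q : Class H) (h : q = toClass q.out) : spoke q q.out h = 𝟙 _ := by
  simp [spoke]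

/-- The loop at the base point of a component obtained from an arrow. -/
noncomputable def baseLoop (q : Class H) {a b : H} (ha : q = toClass a) (hb : q = toClass b)
    (p : a ⟶ b) : End q.out :=
  spoke q a ha ≫ p ≫ inv (spoke q b hb)

lemma baseLoop_comp (q : Class H) {a b c : H} (ha : q = toClass a) (hb : q = toClass b)
    (hc : q = toClass c) (p : a ⟶ b) (p' : b ⟶ c) :
    baseLoop q ha hc (p ≫ p') = baseLoop q hb hc p' * baseLoop q ha hb p := by
  simp [baseLoop, End.mul_def]

lemma baseLoop_end (q : Class H) (h : q = toClass q.out) (p : End q.out) :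
    baseLoop q h h p = p := by
  simp [baseLoop, spoke_out]

lemma baseLoop_spoke (q : Class H) {a : H} (h : q = toClass q.out) (ha : q = toClass a) :
    baseLoop q h ha (spoke q a ha) = 1 := by
  simp [baseLoop, spoke_out, End.one_def]

lemma eq_inv_spoke_comp_baseLoop_comp_spoke (q : Class H) {a b : H} (ha : q = toClass a)
    (hb : q = toClass b) (p : a ⟶ b) :
    p = inv (spoke q a ha) ≫ (show q.out ⟶ q.out from baseLoop q ha hb p) ≫ spoke q b hb := by
  simp [baseLoop]

/-- Homomorphisms on the vertex groups at the base points and a potential on the objects define a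
functor to a group. -/
noncomputable def functorOfEndHom {X : Type*} [Group X] (φ : ∀ q : Class H, End q.out →* X)
    (v : H → X) : H ⥤ SingleObj X :=
  functorOfMap
    (fun {a b} p => v b * φ (toClass a) (baseLoop _ rfl (toClass_eq_of_hom p) p) * (v a)⁻¹)
    (by
      intro a b c p p'
      have hφ : ∀ (q : Class H) (hb : q = toClass b) (hc : q = toClass c),
          φ (toClass b) (baseLoop _ rfl (toClass_eq_of_hom p') p') = φ q (baseLoop q hb hc p') := by
        rintro _ rfl _
        rfl
      rw [hφ _ (toClass_eq_of_hom p) (toClass_eq_of_hom (p ≫ p')),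
        baseLoop_comp _ rfl (toClass_eq_of_hom p) (toClass_eq_of_hom (p ≫ p')), map_mul]
      group)

lemma mapVal_functorOfEndHom {X : Type*} [Group X] (φ : ∀ q : Class H, End q.out →* X)
    (v : H → X) (q : Class H) {a b : H} (ha : q = toClass a) (hb : q = toClass b) (p : a ⟶ b) :
    mapVal (functorOfEndHom φ v) p = v b * φ q (baseLoop q ha hb p) * (v a)⁻¹ := by
  subst ha
  rfl

/-- Two functors to a group agree if they agree on the vertex groups at the base points and on the
spokes. -/
lemma functor_ext_of_spoke {X : Type*} [Group X] {F F' : H ⥤ SingleObj X}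
    (hend : ∀ q : Class H, endHom F q.out = endHom F' q.out)
    (hspoke : ∀ (q : Class H) (a : H) (h : q = toClass a), q.out ≠ a →
      mapVal F (spoke q a h) = mapVal F' (spoke q a h)) : F = F' := by
  have hs (q : Class H) (a : H) (h : q = toClass a) :
      mapVal F (spoke q a h) = mapVal F' (spoke q a h) := by
    by_cases h' : q.out = a
    · subst h'
      rw [spoke_out, mapVal_id, mapVal_id]
    · exact hspoke q a h h'
  have hinv (E : H ⥤ SingleObj X) {a b : H} (p : a ⟶ b) : mapVal E (inv p) = (mapVal E p)⁻¹ := by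
    rw [eq_inv_iff_mul_eq_one, ← mapVal_comp, IsIso.hom_inv_id, mapVal_id]
  refine mapVal_injective fun {a b} p => ?_
  have hl : mapVal F (baseLoop _ rfl (toClass_eq_of_hom p) p) =
      mapVal F' (baseLoop _ rfl (toClass_eq_of_hom p) p) :=
    DFunLike.congr_fun (hend (toClass a)) _
  rw [eq_inv_spoke_comp_baseLoop_comp_spoke _ rfl (toClass_eq_of_hom p) p]
  simp only [mapVal_comp, hinv, hs]
  rw [hl]

/-- The generating arrows of a groupoid with free vertex groups: generators of the vertex groups at
the base points, and an arrow from the base point to every other object of the component. -/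
inductive BaseGenerator (H : Type u) [Groupoid.{u} H] [∀ a : H, IsFreeGroup (End a)] :
    H → H → Type u
  | loop (q : Class H) (s : IsFreeGroup.Generators (End q.out)) : BaseGenerator H q.out q.out
  | spoke (q : Class H) (a : H) (h : q = toClass a) (h' : q.out ≠ a) : BaseGenerator H q.out a

/-- The arrow underlying a generator. -/
noncomputable def BaseGenerator.hom [∀ a : H, IsFreeGroup (End a)] {a b : H} :
    BaseGenerator H a b → (a ⟶ b)
  | .loop q s => (show End q.out from IsFreeGroup.of s)
  | .spoke q a h _ => IsFreeGroupoid.spoke q a h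

open scoped Classical in
/-- A groupoid all of whose vertex groups are free is free. -/
noncomputable abbrev ofIsFreeGroupEnd [∀ a : H, IsFreeGroup (End a)] : IsFreeGroupoid H where
  quiverGenerators := ⟨fun a b => BaseGenerator H a b⟩
  of e := BaseGenerator.hom e
  unique_lift {X} _ f := by
    let f' : ∀ a b : H, BaseGenerator H a b → X := fun a b e => f (a := a) (b := b) e
    let φ : ∀ q : Class H, End q.out →* X := fun q => IsFreeGroup.lift fun s => f' _ _ (.loop q s)
    let v : H → X := fun a =>
      if h : (toClass a).out = a then 1 else f' _ _ (.spoke (toClass a) a rfl h)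
    have hv (q : Class H) : v q.out = 1 := dif_pos (congrArg Quotient.out q.out_eq)
    have hF : ∀ (a b : H) (g : BaseGenerator H a b),
        mapVal (functorOfEndHom φ v) g.hom = f' a b g := by
      rintro _ a (⟨q, s⟩ | ⟨q, _, h, h'⟩)
      · have hq : q = toClass q.out := q.out_eq.symm
        rw [mapVal_functorOfEndHom φ v q hq hq, hv, inv_one, one_mul, mul_one]
        exact (congrArg (φ q) (baseLoop_end q hq _)).trans (IsFreeGroup.lift_of _ s)
      · rw [mapVal_functorOfEndHom φ v q q.out_eq.symm h, hv, inv_one, mul_one]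
        refine (congrArg (v a * φ q ·) (baseLoop_spoke q q.out_eq.symm h)).trans ?_
        subst h
        exact (congrArg₂ (· * ·) (dif_neg h') (map_one _)).trans (mul_one _)
    refine ⟨functorOfEndHom φ v, hF, fun E hE => ?_⟩
    have hE' : ∀ (a b : H) (g : BaseGenerator H a b), mapVal E g.hom = f' a b g := hE
    refine functor_ext_of_spoke (fun q => IsFreeGroup.ext_hom fun s => ?_) fun q a h h' => ?_
    · exact (hE' _ _ (.loop q s)).trans (hF _ _ (.loop q s)).symm
    · exact (hE' _ _ (.spoke q a h h')).trans (hF _ _ (.spoke q a h h')).symm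

end FreeEnd

end IsFreeGroupoid

/-- Freeness of groupoids is preserved by equivalences: if `G` and `H` are small groupoids
and `G ≌ H`, then `H` is a free groupoid whenever `G` is. -/
theorem isFreeGroupoid_of_equivalence {G H : Type u} [Groupoid.{u} G] [Groupoid.{u} H]
    (e : G ≌ H) (h : Nonempty (IsFreeGroupoid G)) : Nonempty (IsFreeGroupoid H) := by
  obtain ⟨_⟩ := h
  have (y : H) : IsFreeGroup (End y) :=
    have := IsFreeGroupoid.isFreeGroup_end (e.inverse.obj y)
    IsFreeGroup.ofMulEquiv (e.fullyFaithfulInverse.mulEquivEnd y).symm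
  exact ⟨IsFreeGroupoid.ofIsFreeGroupEnd⟩
end

section
/- Subgroupoids of free groupoids are free: let G be a small groupoid which is free, i.e. Nonempty (IsFreeGroupoid G), and let S : Subgroupoid G be a subgroupoid of G. Then the groupoid S.objs (with objects the vertices of S and morphisms the arrows of S, with its induced groupoid structure) is free, i.e. Nonempty (IsFreeGroupoid S.objs). -/
open CategoryTheory

noncomputable section

namespace CategoryTheory.Groupoid

universe v u w

variable {H : Type u} [Groupoid.{v} H]

/-- A chosen representative of the connected component of `a`. -/
def componentRoot (a : H) : H :=
  (_root_.Quotient.mk (isIsomorphicSetoid H) a).out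

theorem componentRoot_eq_of_hom {a b : H} (p : a ⟶ b) : componentRoot a = componentRoot b :=
  congrArg _root_.Quotient.out (_root_.Quotient.sound (s := isIsomorphicSetoid H) ⟨asIso p⟩)

theorem nonempty_componentRoot_hom (a : H) : Nonempty (componentRoot a ⟶ a) :=
  let ⟨e⟩ := _root_.Quotient.mk_out (s := isIsomorphicSetoid H) a
  ⟨e.hom⟩

open scoped Classical in
/-- A chosen arrow from `c` to `a`, which is the identity when `c = a`. -/
def chosenHom (c a : H) (h : Nonempty (c ⟶ a)) : c ⟶ a :=
  if e : c = a then eqToHom e else h.some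

@[simp]
theorem chosenHom_self (c : H) (h : Nonempty (c ⟶ c)) : chosenHom c c h = 𝟙 c := by
  simp [chosenHom]

theorem componentRoot_idem (a : H) : componentRoot (componentRoot a) = componentRoot a :=
  componentRoot_eq_of_hom (nonempty_componentRoot_hom a).some

/-- The loop at `c` obtained by conjugating `p` with the chosen arrows out of `c`. -/
def loopAt (c : H) {a b : H} (p : a ⟶ b) (ha : Nonempty (c ⟶ a)) : End c :=
  chosenHom c a ha ≫ p ≫ CategoryTheory.inv (chosenHom c b (ha.map (· ≫ p)))

theorem loopAt_id (c a : H) (ha : Nonempty (c ⟶ a)) : loopAt c (𝟙 a) ha = 1 := by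
  simp [loopAt, End.one_def]

theorem loopAt_comp (c : H) {a b d : H} (p : a ⟶ b) (q : b ⟶ d) (ha : Nonempty (c ⟶ a)) :
    loopAt c (p ≫ q) ha = loopAt c q (ha.map (· ≫ p)) * loopAt c p ha := by
  simp [loopAt, End.mul_def]

/-- The functor to a group determined by homomorphisms from the vertex groups and the images
of the chosen arrows from the component roots. -/
def functorOfVertexHoms {X : Type w} [Group X] (φ : ∀ c : H, End c →* X) (s : H → X) :
    H ⥤ SingleObj X where
  obj _ := SingleObj.star X
  map {a b} p :=
    s b * φ (componentRoot a) (loopAt _ p (nonempty_componentRoot_hom a)) * (s a)⁻¹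
  map_id a := by
    rw [loopAt_id, map_one, mul_one, mul_inv_cancel, SingleObj.id_as_one]
  map_comp {a b d} p q := by
    have key : ∀ c (hc : componentRoot a = c) (h : Nonempty (c ⟶ b)),
        φ c (loopAt c q h) = φ (componentRoot a)
          (loopAt _ q ((nonempty_componentRoot_hom a).map (· ≫ p))) := by
      rintro _ rfl _
      rfl
    rw [SingleObj.comp_as_mul, key _ (componentRoot_eq_of_hom p), loopAt_comp, map_mul]
    group

theorem functorOfVertexHoms_map {X : Type w} [Group X] (φ : ∀ c : H, End c →* X) (s : H → X)
    {a b : H} (p : a ⟶ b) {c : H} (hc : componentRoot a = c) (h : Nonempty (c ⟶ a)) :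
    (functorOfVertexHoms φ s).map p = (s b * φ c (loopAt c p h) * (s a)⁻¹ : X) := by
  subst hc
  rfl

/-- A functor to a group is determined by its values on the vertex groups at the component roots
and on the chosen arrows from the component roots. -/
theorem eq_functorOfVertexHoms {X : Type w} [Group X] (φ : ∀ c : H, End c →* X) (s : H → X)
    (E : H ⥤ SingleObj X)
    (hφ : ∀ c : H, componentRoot c = c → ∀ x : End c, E.map x = φ c x)
    (hs : ∀ a : H, E.map (chosenHom _ a (nonempty_componentRoot_hom a)) = s a) :
    E = functorOfVertexHoms φ s := by
  have hs' : ∀ (a c : H) (_ : componentRoot a = c) (h : Nonempty (c ⟶ a)),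
      E.map (chosenHom c a h) = s a := by
    rintro a _ rfl _
    exact hs a
  refine Functor.hext (fun _ => rfl) fun a b p => heq_of_eq ?_
  have h := hφ _ (componentRoot_idem a) (loopAt _ p (nonempty_componentRoot_hom a))
  rw [loopAt, E.map_comp, E.map_comp, E.map_inv, SingleObj.inv_as_inv, hs' a _ rfl,
    hs' b _ (componentRoot_eq_of_hom p).symm, SingleObj.comp_as_mul,
    SingleObj.comp_as_mul] at h
  rw [functorOfVertexHoms_map φ s p rfl (nonempty_componentRoot_hom a), loopAt, ← h]
  change (E.map p : X) = s b * ((s b)⁻¹ * (E.map p : X) * s a) * (s a)⁻¹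
  group

/-- The generators of a groupoid with free vertex groups: free generators of the vertex groups at
the component roots, and one arrow from the component root to every other object. -/
inductive VertexGenerator [∀ a : H, IsFreeGroup (End a)] : H → H → Type (max u v)
  | tree (a : H) (h : componentRoot a ≠ a) : VertexGenerator (componentRoot a) a
  | loop (a : H) (h : componentRoot a = a) (x : IsFreeGroup.Generators (End a)) :
      VertexGenerator a a

/-- The arrow named by a generator. -/
def VertexGenerator.hom [∀ a : H, IsFreeGroup (End a)] {a b : H} :
    VertexGenerator a b → (a ⟶ b)
  | .tree a _ => chosenHom _ a (nonempty_componentRoot_hom a)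
  | .loop a _ x => (IsFreeGroup.of x : End a)

open scoped Classical in
/-- Every labelling of the generators by elements of a group extends uniquely to a functor. -/
theorem existsUnique_functor_of_isFreeGroup_end [∀ a : H, IsFreeGroup (End a)]
    {X : Type w} [Group X] (f : ∀ ⦃a b : H⦄, VertexGenerator a b → X) :
    ∃! F : H ⥤ SingleObj X, ∀ (a b : H) (g : VertexGenerator a b), F.map g.hom = f g := by
  let φ (c : H) : End c →* X :=
    if h : componentRoot c = c then IsFreeGroup.lift fun x => f (.loop c h x) else 1
  let s (a : H) : X := if h : componentRoot a = a then 1 else f (.tree a h)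
  have hs (a : H) (h : componentRoot a = a) : s a = 1 := dif_pos h
  have hφ (c : H) (h : componentRoot c = c) (x : IsFreeGroup.Generators (End c)) :
      φ c (IsFreeGroup.of x) = f (.loop c h x) := by
    simp only [φ, dif_pos h, IsFreeGroup.lift_of]
  refine ⟨functorOfVertexHoms φ s, ?_, fun E hE => eq_functorOfVertexHoms φ s E ?_ ?_⟩
  · rintro a b (⟨_, h⟩ | ⟨_, h, x⟩)
    · rw [functorOfVertexHoms_map φ s _ (componentRoot_idem b) ⟨𝟙 _⟩, hs _ (componentRoot_idem b)]
      have : loopAt (componentRoot b) (VertexGenerator.tree b h).hom ⟨𝟙 _⟩ = 1 := by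
        simp [loopAt, VertexGenerator.hom, End.one_def]
      rw [this, map_one, mul_one, inv_one, mul_one]
      exact dif_neg h
    · rw [functorOfVertexHoms_map φ s _ h ⟨𝟙 _⟩, hs _ h]
      have : loopAt a (VertexGenerator.loop a h x).hom ⟨𝟙 _⟩ = IsFreeGroup.of x := by
        simp [loopAt, VertexGenerator.hom]
      rw [this, hφ _ h, one_mul, inv_one, mul_one]
  · intro c hc x
    have : (E.mapEnd c : End c →* X) = φ c :=
      IsFreeGroup.ext_hom fun y => (hE c c (.loop c hc y)).trans (hφ c hc y).symm
    exact DFunLike.congr_fun this x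
  · intro a
    by_cases h : componentRoot a = a
    · have key : ∀ c (_ : c = a) (h' : Nonempty (c ⟶ a)), E.map (chosenHom c a h') = (1 : X) := by
        rintro _ rfl _
        rw [chosenHom_self, E.map_id, SingleObj.id_as_one]
      rw [key _ h, hs a h]
    · have hsa : s a = f (.tree a h) := dif_neg h
      exact (hE _ _ (.tree a h)).trans hsa.symm

open scoped Classical in
/-- For every object `r` of a groupoid there is a functor to a group which is injective on
the loops at `r`. -/
theorem exists_functor_injective_end (r : H) :
    ∃ F : H ⥤ SingleObj (End r), Function.Injective fun x : r ⟶ r => F.map x := by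
  let F : H ⥤ SingleObj (End r) :=
    { obj _ := SingleObj.star _
      map {a _} p := if h : Nonempty (r ⟶ a) then loopAt r p h else 1
      map_id a := by
        rw [SingleObj.id_as_one]
        split_ifs with h
        · exact loopAt_id r a h
        · rfl
      map_comp {a b d} p q := by
        by_cases h : Nonempty (r ⟶ a)
        · have h' : Nonempty (r ⟶ b) := h.map (· ≫ p)
          simp only [h, h', dif_pos]
          exact loopAt_comp r p q h
        · have h' : ¬ Nonempty (r ⟶ b) := fun k => h (k.map (· ≫ CategoryTheory.inv p))
          simp only [h, h', dif_neg, not_false_eq_true]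
          exact (mul_one (1 : End r)).symm }
  refine ⟨F, fun x y hxy => ?_⟩
  have key (z : r ⟶ r) : F.map z = (z : End r) := by
    change (if h : Nonempty (r ⟶ r) then loopAt r z h else 1) = z
    rw [dif_pos ⟨𝟙 r⟩]
    simp [loopAt]
  exact (key x).symm.trans (hxy.trans (key y))

end CategoryTheory.Groupoid

namespace IsFreeGroupoid

open CategoryTheory.Groupoid

universe u

/-- A groupoid all of whose vertex groups are free is free. -/
theorem nonempty_of_isFreeGroup_end (H : Type u) [Groupoid.{u} H]
    [∀ a : H, IsFreeGroup (End a)] : Nonempty (IsFreeGroupoid H) :=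
  ⟨{ quiverGenerators := ⟨fun a b => VertexGenerator (H := H) a b⟩
     of {a b} g := VertexGenerator.hom (H := H) (a := a) (b := b) g
     unique_lift f := existsUnique_functor_of_isFreeGroup_end (H := H) f }⟩

variable (G : Type u) [Groupoid.{u} G] [IsFreeGroupoid G]

/-- The functor from a free groupoid to the free group on its generators. -/
def toFreeGroup : G ⥤ SingleObj (FreeGroup (Quiver.Total (Generators G))) :=
  (unique_lift fun a b (e : a ⟶ b) => FreeGroup.of (Quiver.Total.mk a b e)).choose

theorem toFreeGroup_map_of {a b : Generators G} (e : a ⟶ b) :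
    (toFreeGroup G).map (of e) = FreeGroup.of (Quiver.Total.mk a b e) :=
  (unique_lift fun a b (e : a ⟶ b) =>
    FreeGroup.of (Quiver.Total.mk a b e)).choose_spec.1 a b e

variable {G}

/-- Every functor from a free groupoid to a group factors through `toFreeGroup`. -/
theorem exists_toFreeGroup_comp_eq {X : Type u} [Group X] (F : G ⥤ SingleObj X) :
    ∃ φ : FreeGroup (Quiver.Total (Generators G)) →* X,
      toFreeGroup G ⋙ SingleObj.mapHom _ _ φ = F := by
  refine ⟨FreeGroup.lift fun e => F.map (of e.hom), ext_functor _ _ fun a b e => ?_⟩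
  exact (congrArg _ (toFreeGroup_map_of G e)).trans FreeGroup.lift_apply_of

theorem toFreeGroup_injective_end (r : G) :
    Function.Injective fun x : r ⟶ r => (toFreeGroup G).map x := by
  obtain ⟨F, hF⟩ := exists_functor_injective_end r
  obtain ⟨φ, rfl⟩ := exists_toFreeGroup_comp_eq F
  exact fun x y hxy => hF (congrArg φ hxy)

theorem isFreeGroup_end_subgroupoid (S : Subgroupoid G) (a : S.objs) : IsFreeGroup (End a) := by
  let φ : End a →* FreeGroup (Quiver.Total (Generators G)) := (S.hom ⋙ toFreeGroup G).mapEnd a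
  have hφ : Function.Injective φ := fun x y hxy =>
    Subgroupoid.hom.faithful S a a (toFreeGroup_injective_end a.val hxy)
  exact IsFreeGroup.ofMulEquiv (MonoidHom.ofInjective hφ).symm

end IsFreeGroupoid

end

/-- Subgroupoids of free groupoids are free: if `G` is a free small groupoid and
`S : Subgroupoid G`, then the groupoid `S.objs` (objects the vertices of `S`, morphisms
the arrows of `S`) is free. -/
theorem subgroupoid_of_free_isFree {G : Type u} [Groupoid.{u} G]
    (hfree : Nonempty (IsFreeGroupoid G)) (S : Subgroupoid G) :
    Nonempty (IsFreeGroupoid S.objs) := by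
  obtain ⟨_⟩ := hfree
  have := IsFreeGroupoid.isFreeGroup_end_subgroupoid S
  exact IsFreeGroupoid.nonempty_of_isFreeGroup_end S.objs
end

section
/- The forgetful functor from groupoids to categories creates coequalizers and coproducts: the functor Grpd.forgetToCat : Grpd ⥤ Cat creates colimits of shape WalkingParallelPair (coequalizers) and colimits of any small discrete shape (coproducts). -/
open CategoryTheory

namespace CategoryTheory

/-- A category whose core inclusion has a section is a groupoid. -/
theorem isGroupoid_of_comp_inclusion_eq_id {C : Type u} [Category.{v} C] (s : C ⥤ Core C)
    (h : s ⋙ Core.inclusion C = 𝟭 C) : IsGroupoid C where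
  all_isIso f := (NatIso.isIso_map_iff (eqToIso h) f).1
    (inferInstanceAs (IsIso ((Core.inclusion C).map (s.map f))))

namespace Grpd

variable {J : Type w} [Category.{w'} J] {K : J ⥤ Grpd.{v, u}}

/-- A cocone in `Cat` over a diagram of groupoids factors through the core of its point. -/
def coreCocone (c : Limits.Cocone (K ⋙ forgetToCat.{v, u})) :
    Limits.Cocone (K ⋙ forgetToCat.{v, u}) where
  pt := Cat.of (Core c.pt)
  ι :=
    { app j := (Core.functorToCore (G := K.obj j) (c.ι.app j).toFunctor).toCatHom
      naturality i j f := by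
        apply Cat.ext
        exact (Core.functorToCore_comp_left (G := K.obj j) (G' := K.obj i)
          (c.ι.app j).toFunctor (K.map f)).symm.trans
            (congrArg (fun F ↦ Core.functorToCore (G := K.obj i) F)
              (congrArg Cat.Hom.toFunctor (c.w f))) }

/-- The inclusion of the core of the point of a cocone in `Cat` over a diagram of groupoids. -/
def coreCoconeInclusion (c : Limits.Cocone (K ⋙ forgetToCat.{v, u})) :
    (coreCocone c).pt ⟶ c.pt :=
  (Core.inclusion c.pt).toCatHom

theorem coreCocone_ι_comp_inclusion (c : Limits.Cocone (K ⋙ forgetToCat.{v, u})) (j : J) :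
    (coreCocone c).ι.app j ≫ coreCoconeInclusion c = c.ι.app j :=
  rfl

/-- The point of a colimit cocone in `Cat` over a diagram of groupoids is a groupoid. -/
theorem isGroupoid_pt_of_isColimit {c : Limits.Cocone (K ⋙ forgetToCat.{v, u})}
    (hc : Limits.IsColimit c) : IsGroupoid c.pt := by
  refine isGroupoid_of_comp_inclusion_eq_id (hc.desc (coreCocone c)).toFunctor ?_
  refine congrArg Cat.Hom.toFunctor
    (hc.hom_ext (f := hc.desc (coreCocone c) ≫ coreCoconeInclusion c)
      (f' := 𝟙 c.pt) fun j ↦ ?_)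
  rw [hc.fac_assoc, Category.comp_id, coreCocone_ι_comp_inclusion]

/-- The forgetful functor from groupoids to categories creates all colimits. -/
noncomputable instance : CreatesColimitsOfShape J forgetToCat.{v, u} where
  CreatesColimit :=
    { toReflectsColimit := inferInstance
      lifts c hc :=
        letI := isGroupoid_pt_of_isColimit hc
        letI : Groupoid c.pt := Groupoid.ofIsGroupoid
        (createsColimitOfFullyFaithfulOfIso' hc (Grpd.of c.pt) (Iso.refl c.pt)).lifts c hc }

end Grpd

end CategoryTheory

/-- The forgetful functor from groupoids to categories creates coequalizers and coproducts:
`Grpd.forgetToCat : Grpd ⥤ Cat` creates colimits of shape `WalkingParallelPair`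
(coequalizers) and colimits of any small discrete shape (coproducts). -/
theorem grpd_forgetToCat_creates_coequalizers_and_coproducts :
    Nonempty
      (CreatesColimitsOfShape Limits.WalkingParallelPair Grpd.forgetToCat.{v, u}) ∧
    ∀ J : Type w,
      Nonempty (CreatesColimitsOfShape (Discrete J) Grpd.forgetToCat.{v, u}) :=
  ⟨⟨inferInstance⟩, fun _ ↦ ⟨inferInstance⟩⟩
end
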